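/- If Y ⊊ ℂ is a simply connected domain and Ω ⊊ ℂ is any domain, then η_Ω^𝔻(w) = η_Ω^Y(w) = η_Ω(w) for all w ∈ Ω. -/

import Mathlib

open Complex Set Metric
open scoped ENNReal

noncomputable section

/-- The open unit disk in the complex plane. -/
def unitDisk : Set ℂ := Metric.ball (0 : ℂ) 1

/-- A plane domain: a nonempty open connected subset of ℂ. -/
def IsPlaneDomain (S : Set ℂ) : Prop := IsOpen S ∧ IsConnected S

/-- The Hurwitz radius `r_Ω(w)`: the supremum of `h'(0)` over all holomorphic
`h : 𝔻 → Ω` with `h 0 = w`, `h t ≠ w` for `t ∈ 𝔻 \ {0}`, and `h'(0) > 0` (real). -/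
def hurwitzRadius (Ω : Set ℂ) (w : ℂ) : ℝ :=
  sSup { r : ℝ | 0 < r ∧ ∃ h : ℂ → ℂ, DifferentiableOn ℂ h unitDisk ∧
    Set.MapsTo h unitDisk Ω ∧ h 0 = w ∧ (∀ t ∈ unitDisk, t ≠ 0 → h t ≠ w) ∧
    deriv h 0 = (r : ℂ) }

/-- The Hurwitz density `η_Ω(w) = 2 / r_Ω(w)`. -/
def hurwitzDensity (Ω : Set ℂ) (w : ℂ) : ℝ := 2 / hurwitzRadius Ω w

/-- A (C¹, hence rectifiable) path in `Ω` from `w₁` to `w₂`, parametrized on `[0,1]`. -/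
def IsPathIn (Ω : Set ℂ) (w₁ w₂ : ℂ) (γ : ℝ → ℂ) : Prop :=
  γ 0 = w₁ ∧ γ 1 = w₂ ∧ (∀ t ∈ Set.Icc (0:ℝ) 1, γ t ∈ Ω) ∧
    ContDiffOn ℝ 1 γ (Set.Icc (0:ℝ) 1)

/-- The Hurwitz distance: infimum of Hurwitz lengths of rectifiable paths in `Ω`. -/
def hurwitzDist (Ω : Set ℂ) (w₁ w₂ : ℂ) : ℝ :=
  sInf { L : ℝ | ∃ γ : ℝ → ℂ, IsPathIn Ω w₁ w₂ γ ∧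
    L = ∫ t in (0:ℝ)..1, hurwitzDensity Ω (γ t) * ‖derivWithin γ (Set.Icc (0:ℝ) 1) t‖ }

/-- The generalized Hurwitz density `η_Ω^Y(w)` with basepoint domain `Y`
(`+∞` if no admissible map exists). -/
def genHurwitzDensity (Y Ω : Set ℂ) (w : ℂ) : ℝ≥0∞ :=
  sInf { x : ℝ≥0∞ | ∃ s ∈ Y, ∃ h : ℂ → ℂ, DifferentiableOn ℂ h Y ∧
    Set.MapsTo h Y Ω ∧ h s = w ∧ (∀ t ∈ Y, t ≠ s → h t ≠ w) ∧ deriv h s ≠ 0 ∧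
    x = ENNReal.ofReal (hurwitzDensity Y s / ‖deriv h s‖) }

/-- The generalized Hurwitz distance `η_Ω^Y(z₁,z₂)`. -/
def genHurwitzDist (Y Ω : Set ℂ) (z₁ z₂ : ℂ) : ℝ≥0∞ :=
  sInf { L : ℝ≥0∞ | ∃ γ : ℝ → ℂ, IsPathIn Ω z₁ z₂ γ ∧
    L = ∫⁻ t in Set.Icc (0:ℝ) 1,
      genHurwitzDensity Y Ω (γ t) * ENNReal.ofReal ‖derivWithin γ (Set.Icc (0:ℝ) 1) t‖ }

/-- The infinitesimal contraction constant `l_η(Ω, Y)`. -/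
def lEta (Ω Y : Set ℂ) : ℝ :=
  sSup { x : ℝ | ∃ w ∈ Ω, x = hurwitzDensity Y w / hurwitzDensity Ω w }

/-- The global contraction constant `gl_η(Ω, Y)`. -/
def glEta (Ω Y : Set ℂ) : ℝ :=
  sSup { x : ℝ | ∃ w₁ ∈ Ω, ∃ w₂ ∈ Ω, w₁ ≠ w₂ ∧
    x = hurwitzDist Y w₁ w₂ / hurwitzDist Ω w₁ w₂ }
/-- A holomorphic embedding of `U` into the unit disk. -/
structure IsDiskEmbedding (U : Set ℂ) (f : ℂ → ℂ) : Prop where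
  mapsTo : MapsTo f U unitDisk
  injOn : InjOn f U
  deriv_ne_zero : ∀ z ∈ U, deriv f z ≠ 0

/-- The automorphism `z ↦ (z - a) / (1 - ā z)` of the unit disk. -/
def diskAut (a z : ℂ) : ℂ := (z - a) / (1 - starRingEnd ℂ a * z)

theorem mem_unitDisk {z : ℂ} : z ∈ unitDisk ↔ ‖z‖ < 1 := mem_ball_zero_iff

theorem isOpen_unitDisk : IsOpen unitDisk := isOpen_ball

theorem one_sub_conj_mul_ne_zero {a z : ℂ} (ha : ‖a‖ < 1) (hz : ‖z‖ < 1) :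
    1 - starRingEnd ℂ a * z ≠ 0 := by
  intro h
  have h1 : starRingEnd ℂ a * z = 1 := (sub_eq_zero.mp h).symm
  have h2 : ‖a‖ * ‖z‖ = 1 := by simpa using congrArg norm h1
  nlinarith [norm_nonneg a, norm_nonneg z]

theorem one_sub_conj_mul_self_ne_zero {a : ℂ} (ha : ‖a‖ < 1) : 1 - starRingEnd ℂ a * a ≠ 0 :=
  one_sub_conj_mul_ne_zero ha ha

theorem norm_diskAut_lt_one {a z : ℂ} (ha : ‖a‖ < 1) (hz : ‖z‖ < 1) : ‖diskAut a z‖ < 1 := by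
  have h0 := one_sub_conj_mul_ne_zero ha hz
  rw [diskAut, norm_div, div_lt_one (norm_pos_iff.mpr h0)]
  refine lt_of_pow_lt_pow_left₀ 2 (norm_nonneg _) ?_
  have key : ‖1 - starRingEnd ℂ a * z‖ ^ 2 - ‖z - a‖ ^ 2 = (1 - ‖a‖ ^ 2) * (1 - ‖z‖ ^ 2) := by
    simp only [← Complex.normSq_eq_norm_sq, Complex.normSq_apply, Complex.sub_re, Complex.sub_im,
      Complex.mul_re, Complex.mul_im, Complex.conj_re, Complex.conj_im, Complex.one_re,
      Complex.one_im]
    ring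
  have h1 : 0 < 1 - ‖a‖ ^ 2 := by nlinarith [norm_nonneg a]
  have h2 : 0 < 1 - ‖z‖ ^ 2 := by nlinarith [norm_nonneg z]
  nlinarith [mul_pos h1 h2]

theorem hasDerivAt_diskAut {a z : ℂ} (ha : ‖a‖ < 1) (hz : ‖z‖ < 1) :
    HasDerivAt (diskAut a)
      ((1 - starRingEnd ℂ a * a) / (1 - starRingEnd ℂ a * z) ^ 2) z := by
  have h0 := one_sub_conj_mul_ne_zero ha hz
  have := ((hasDerivAt_id z).sub_const a).div
    (((hasDerivAt_id z).const_mul (starRingEnd ℂ a)).const_sub 1) h0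
  refine this.congr_deriv ?_
  simp only [id]
  congr 1
  ring

theorem injOn_diskAut {a : ℂ} (ha : ‖a‖ < 1) : InjOn (diskAut a) unitDisk := by
  intro z hz w hw h
  have hz0 := one_sub_conj_mul_ne_zero ha (mem_unitDisk.mp hz)
  have hw0 := one_sub_conj_mul_ne_zero ha (mem_unitDisk.mp hw)
  rw [diskAut, diskAut, div_eq_div_iff hz0 hw0] at h
  have : (1 - starRingEnd ℂ a * a) * (z - w) = 0 := by linear_combination h
  simpa [one_sub_conj_mul_self_ne_zero ha, sub_eq_zero] using this

theorem diskAut_self (a : ℂ) : diskAut a a = 0 := by simp [diskAut]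

theorem diskAut_zero (a : ℂ) : diskAut a 0 = -a := by simp [diskAut]

theorem diskAut_ne_zero {a z : ℂ} (ha : ‖a‖ < 1) (hz : ‖z‖ < 1) (h : z ≠ a) :
    diskAut a z ≠ 0 :=
  div_ne_zero (sub_ne_zero.mpr h) (one_sub_conj_mul_ne_zero ha hz)

theorem IsDiskEmbedding.differentiableAt {U : Set ℂ} {f : ℂ → ℂ} (hf : IsDiskEmbedding U f)
    {z : ℂ} (hz : z ∈ U) : DifferentiableAt ℂ f z :=
  differentiableAt_of_deriv_ne_zero (hf.deriv_ne_zero z hz)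

theorem IsDiskEmbedding.differentiableOn {U : Set ℂ} {f : ℂ → ℂ} (hf : IsDiskEmbedding U f) :
    DifferentiableOn ℂ f U :=
  fun _ hz => (hf.differentiableAt hz).differentiableWithinAt

theorem IsDiskEmbedding.hasDerivAt_diskAut_comp {U : Set ℂ} {f : ℂ → ℂ}
    (hf : IsDiskEmbedding U f) {a : ℂ} (ha : ‖a‖ < 1) {z : ℂ} (hz : z ∈ U) :
    HasDerivAt (fun z => diskAut a (f z))
      ((1 - starRingEnd ℂ a * a) / (1 - starRingEnd ℂ a * f z) ^ 2 * deriv f z) z :=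
  (hasDerivAt_diskAut ha (mem_unitDisk.mp (hf.mapsTo hz))).comp z
    (hf.differentiableAt hz).hasDerivAt

theorem IsDiskEmbedding.diskAut_comp {U : Set ℂ} {f : ℂ → ℂ} (hf : IsDiskEmbedding U f) {a : ℂ}
    (ha : ‖a‖ < 1) : IsDiskEmbedding U fun z => diskAut a (f z) where
  mapsTo _ hz := mem_unitDisk.mpr (norm_diskAut_lt_one ha (mem_unitDisk.mp (hf.mapsTo hz)))
  injOn := (injOn_diskAut ha).comp hf.injOn hf.mapsTo
  deriv_ne_zero z hz := by
    rw [(hf.hasDerivAt_diskAut_comp ha hz).deriv]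
    exact mul_ne_zero (div_ne_zero (one_sub_conj_mul_self_ne_zero ha) (pow_ne_zero _
      (one_sub_conj_mul_ne_zero ha (mem_unitDisk.mp (hf.mapsTo hz))))) (hf.deriv_ne_zero z hz)

/-- A nonvanishing holomorphic function on a simply connected open set has a holomorphic square
root. -/
theorem exists_holomorphic_sqrt {U : Set ℂ} (hUo : IsOpen U) (hU : IsSimplyConnected U)
    {g : ℂ → ℂ} (hg : DifferentiableOn ℂ g U) (hg0 : ∀ z ∈ U, g z ≠ 0) :
    ∃ h : ℂ → ℂ, (∀ z, h z ^ 2 = g z) ∧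
      ∀ z ∈ U, HasDerivAt h (deriv g z / (2 * h z)) z := by
  obtain ⟨h, hc, hh⟩ := exists_continuousOn_pow_eq hU hUo hg.continuousOn
    (by rintro ⟨z, hz, h0⟩; exact hg0 z hz h0) two_ne_zero
  refine ⟨h, hh, fun z hz => ?_⟩
  have hz0 : h z ≠ 0 := fun h0 => hg0 z hz (by rw [← hh z, h0]; simp)
  have hcz : ContinuousAt h z := hc.continuousAt (hUo.mem_nhds hz)
  have hgz : HasDerivAt g (deriv g z) z :=
    (hg.differentiableAt (hUo.mem_nhds hz)).hasDerivAt
  rw [hasDerivAt_iff_tendsto_slope] at hgz ⊢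
  have hlim : Filter.Tendsto (fun y => slope g z y / (h y + h z)) (nhdsWithin z {z}ᶜ)
      (nhds (deriv g z / (2 * h z))) := by
    refine hgz.div ?_ (by simpa using hz0)
    rw [two_mul]
    exact (hcz.tendsto.mono_left nhdsWithin_le_nhds).add_const _
  refine hlim.congr' ?_
  have hev : ∀ᶠ y in nhds z, h y + h z ≠ 0 :=
    (hcz.add continuousAt_const).eventually_ne (by simpa [← two_mul] using hz0)
  filter_upwards [hev.filter_mono nhdsWithin_le_nhds] with y hy
  rw [slope_def_field, slope_def_field, ← hh y, ← hh z, div_right_comm, sq_sub_sq,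
    mul_div_cancel_left₀ _ hy]

/-- A simply connected proper open subset of `ℂ` embeds holomorphically in the unit disk. -/
theorem exists_isDiskEmbedding {U : Set ℂ} (hUo : IsOpen U) (hU : IsSimplyConnected U)
    (hUp : U ≠ univ) : ∃ f, IsDiskEmbedding U f := by
  obtain ⟨a, ha⟩ := (ne_univ_iff_exists_notMem U).mp hUp
  have hga : ∀ z ∈ U, z - a ≠ 0 := fun z hz h => ha (by rwa [← sub_eq_zero.mp h])
  obtain ⟨h, hsq, hd⟩ := exists_holomorphic_sqrt hUo hU
    (g := fun z => z - a) (by fun_prop) hga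
  have hd' : ∀ z ∈ U, HasDerivAt h (1 / (2 * h z)) z := by
    intro z hz
    simpa using hd z hz
  have h0 : ∀ z ∈ U, h z ≠ 0 := fun z hz h0 => hga z hz (by rw [← hsq z, h0]; simp)
  obtain ⟨x, hx⟩ := hU.nonempty
  have hnhds : h '' U ∈ nhds (h x) := by
    have hdiff : DifferentiableOn ℂ h U :=
      fun z hz => (hd' z hz).differentiableAt.differentiableWithinAt
    have hstrict := (hdiff.analyticAt (hUo.mem_nhds hx)).hasStrictDerivAt
    rw [(hd' x hx).deriv] at hstrict
    rw [← hstrict.map_nhds_eq (by simpa using h0 x hx)]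
    exact Filter.image_mem_map (hUo.mem_nhds hx)
  obtain ⟨ε, hε, hball⟩ := Metric.mem_nhds_iff.mp hnhds
  have hfar : ∀ z ∈ U, ε ≤ ‖h z + h x‖ := by
    intro z hz
    by_contra! hlt
    obtain ⟨y, hy, hyz⟩ := hball (show -h z ∈ ball (h x) ε by
      rwa [mem_ball, dist_eq_norm, ← norm_neg, neg_sub, sub_neg_eq_add, add_comm])
    have : y = z := by
      have h1 := hsq y
      rw [hyz, neg_sq, hsq z] at h1
      linear_combination -h1
    rw [this] at hyz
    exact h0 z hz (by linear_combination hyz / 2)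
  have hne : ∀ z ∈ U, h z + h x ≠ 0 := fun z hz =>
    norm_pos_iff.mp (hε.trans_le (hfar z hz))
  have hε' : (ε : ℂ) / 2 ≠ 0 := by simpa using hε.ne'
  refine ⟨fun z => (ε / 2 : ℂ) / (h z + h x), ?_, ?_, ?_⟩
  · intro z hz
    rw [mem_unitDisk, norm_div, div_lt_one (norm_pos_iff.mpr (hne z hz))]
    refine lt_of_lt_of_le ?_ (hfar z hz)
    rw [norm_div, norm_real, Real.norm_of_nonneg hε.le, Complex.norm_ofNat]
    linarith
  · intro z hz y hy hzy
    simp only [div_eq_mul_inv _ (h _ + h x), mul_right_inj' hε', inv_inj, add_left_inj] at hzy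
    have h1 := hsq y
    rw [← hzy, hsq z] at h1
    linear_combination h1
  · intro z hz
    rw [((hasDerivAt_const z _).fun_div ((hd' z hz).add_const (h x)) (hne z hz)).deriv]
    simp [hne z hz, h0 z hz, hε.ne']

theorem norm_one_sub_conj_mul_self {a : ℂ} (ha : ‖a‖ < 1) :
    ‖1 - starRingEnd ℂ a * a‖ = 1 - ‖a‖ ^ 2 := by
  rw [Complex.conj_mul', ← Complex.ofReal_pow, ← Complex.ofReal_one, ← Complex.ofReal_sub,
    Complex.norm_real, Real.norm_of_nonneg]
  nlinarith [norm_nonneg a]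

/-- Koebe's square root construction: an embedding into the disk omitting `a` can be replaced by
one with a larger derivative. -/
theorem IsDiskEmbedding.exists_deriv_eq {U : Set ℂ} (hUo : IsOpen U) (hU : IsSimplyConnected U)
    {f : ℂ → ℂ} (hf : IsDiskEmbedding U f) {s : ℂ} (hs : s ∈ U) (hfs : f s = 0) {a : ℂ}
    (ha : ‖a‖ < 1) (haf : a ∉ f '' U) :
    ∃ k, IsDiskEmbedding U k ∧ k s = 0 ∧
      ‖deriv k s‖ * (2 * √‖a‖) = ‖deriv f s‖ * (1 + ‖a‖) := by
  have hg := hf.diskAut_comp ha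
  have hg0 : ∀ z ∈ U, diskAut a (f z) ≠ 0 := fun z hz =>
    diskAut_ne_zero ha (mem_unitDisk.mp (hf.mapsTo hz)) fun h => haf ⟨z, hz, h⟩
  obtain ⟨h, hsq, hd⟩ := exists_holomorphic_sqrt hUo hU hg.differentiableOn hg0
  have h0 : ∀ z ∈ U, h z ≠ 0 := fun z hz h0 => hg0 z hz (by rw [← hsq z, h0]; simp)
  have hh : IsDiskEmbedding U h := by
    refine ⟨fun z hz => ?_, fun z hz y hy hzy => ?_, fun z hz => ?_⟩
    · have := mem_unitDisk.mp (hg.mapsTo hz)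
      rw [← hsq z, norm_pow] at this
      exact mem_unitDisk.mpr ((sq_lt_one_iff₀ (norm_nonneg _)).mp this)
    · exact hg.injOn hz hy (by simp only [← hsq, hzy])
    · rw [(hd z hz).deriv]
      exact div_ne_zero (hg.deriv_ne_zero z hz) (mul_ne_zero two_ne_zero (h0 z hz))
  have hb : ‖h s‖ < 1 := mem_unitDisk.mp (hh.mapsTo hs)
  refine ⟨_, hh.diskAut_comp hb, diskAut_self _, ?_⟩
  have hba : ‖h s‖ ^ 2 = ‖a‖ := by
    rw [← norm_pow, hsq, hfs, diskAut_zero, norm_neg]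
  have hb0 : 0 < ‖h s‖ := norm_pos_iff.mpr (h0 s hs)
  rw [← hba, Real.sqrt_sq hb0.le, (hh.hasDerivAt_diskAut_comp hb hs).deriv, (hd s hs).deriv,
    (hf.hasDerivAt_diskAut_comp ha hs).deriv, hfs]
  simp only [norm_mul, norm_div, norm_pow, norm_one_sub_conj_mul_self hb,
    norm_one_sub_conj_mul_self ha, mul_zero, sub_zero, one_pow, div_one,
    Complex.norm_ofNat]
  rw [← hba]
  have h1 : 1 - ‖h s‖ ^ 2 ≠ 0 := by nlinarith
  field_simp
  ring

/-- Embeddings of a simply connected domain in the disk fixing a base point can be chosen to cover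
an arbitrarily large concentric disk. -/
theorem exists_isDiskEmbedding_ball_subset {U : Set ℂ} (hUo : IsOpen U)
    (hU : IsSimplyConnected U) (hUp : U ≠ univ) {s : ℂ} (hs : s ∈ U) {ρ : ℝ} (hρ0 : 0 < ρ)
    (hρ : ρ < 1) : ∃ f, IsDiskEmbedding U f ∧ f s = 0 ∧ ball 0 ρ ⊆ f '' U := by
  set V : Set ℝ := {x | ∃ f, IsDiskEmbedding U f ∧ f s = 0 ∧ x = ‖deriv f s‖} with hV
  have hne : V.Nonempty := by
    obtain ⟨f, hf⟩ := exists_isDiskEmbedding hUo hU hUp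
    exact ⟨_, _, hf.diskAut_comp (mem_unitDisk.mp (hf.mapsTo hs)), diskAut_self _, rfl⟩
  obtain ⟨δ, hδ, hball⟩ := Metric.isOpen_iff.mp hUo s hs
  have hbdd : BddAbove V := by
    refine ⟨1 / δ, ?_⟩
    rintro _ ⟨f, hf, hfs, rfl⟩
    refine norm_deriv_le_div_of_mapsTo_ball (hf.differentiableOn.mono hball) ?_ hδ
    rw [hfs]
    exact fun z hz => ball_subset_closedBall (hf.mapsTo (hball hz))
  have hM : 0 < sSup V := by
    obtain ⟨_, f, hf, hfs, rfl⟩ := hne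
    exact (norm_pos_iff.mpr (hf.deriv_ne_zero s hs)).trans_le (le_csSup hbdd ⟨f, hf, hfs, rfl⟩)
  set σ := √ρ
  have hσ0 : 0 < σ := Real.sqrt_pos.mpr hρ0
  have hσ : σ ^ 2 = ρ := Real.sq_sqrt hρ0.le
  have hσ1 : σ < 1 := by nlinarith
  have hlt : sSup V * (2 * σ) / (1 + σ ^ 2) < sSup V := by
    rw [div_lt_iff₀ (by positivity)]
    exact mul_lt_mul_of_pos_left (by nlinarith [mul_pos (sub_pos.mpr hσ1) (sub_pos.mpr hσ1)]) hM
  obtain ⟨_, ⟨f, hf, hfs, rfl⟩, hfd⟩ := exists_lt_of_lt_csSup hne hlt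
  refine ⟨f, hf, hfs, fun a ha => ?_⟩
  by_contra haf
  rw [mem_ball_zero_iff] at ha
  obtain ⟨k, hk, hks, hkd⟩ := hf.exists_deriv_eq hUo hU hs hfs (ha.trans hρ) haf
  have hkM : ‖deriv k s‖ ≤ sSup V := le_csSup hbdd ⟨k, hk, hks, rfl⟩
  rw [div_lt_iff₀ (by positivity)] at hfd
  set β := √‖a‖
  have ha0 : a ≠ 0 := by
    rintro rfl
    exact haf ⟨s, hs, hfs⟩
  have hβ0 : 0 < β := Real.sqrt_pos.mpr (norm_pos_iff.mpr ha0)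
  have hβ : β ^ 2 = ‖a‖ := Real.sq_sqrt (norm_nonneg a)
  have hβσ : β < σ := Real.sqrt_lt_sqrt (norm_nonneg a) ha
  rw [← hβ] at hkd
  have h1 : ‖deriv k s‖ * (2 * β) * σ ≤ sSup V * (2 * β) * σ := by gcongr
  have h2 : sSup V * (2 * σ) * β < ‖deriv f s‖ * (1 + σ ^ 2) * β := by gcongr
  have h3 : ‖deriv f s‖ * ((1 + σ ^ 2) * β) ≤ ‖deriv f s‖ * ((1 + β ^ 2) * σ) := by
    gcongr ‖deriv f s‖ * ?_
    nlinarith [mul_pos (sub_pos.mpr hβσ) (show 0 < 1 - σ * β by nlinarith)]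
  rw [hkd] at h1
  nlinarith

theorem IsDiskEmbedding.exists_inverse {U : Set ℂ} (hUo : IsOpen U) {f : ℂ → ℂ}
    (hf : IsDiskEmbedding U f) :
    ∃ g : ℂ → ℂ, LeftInvOn g f U ∧ ∀ z ∈ U, HasDerivAt g (deriv f z)⁻¹ (f z) := by
  have hinv : LeftInvOn (Function.invFunOn f U) f U := hf.injOn.leftInvOn_invFunOn
  refine ⟨_, hinv, fun z hz => ?_⟩
  have hstrict := (hf.differentiableOn.analyticAt (hUo.mem_nhds hz)).hasStrictDerivAt
  have hne := hf.deriv_ne_zero z hz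
  have hloc := hstrict.to_localInverse hne
  refine hloc.hasDerivAt.congr_of_eventuallyEq ?_
  have h1 := hstrict.eventually_right_inverse hne
  have h2 : ∀ᶠ y in nhds (f z), hstrict.localInverse f (deriv f z) z hne y ∈ U := by
    refine hloc.hasDerivAt.continuousAt.eventually_mem (hUo.mem_nhds ?_)
    rwa [(hstrict.eventually_left_inverse hne).self_of_nhds]
  filter_upwards [h1, h2] with y hy hyU
  conv_lhs => rw [← hy]
  exact hinv hyU

/-- The derivatives competing in the definition of the Hurwitz radius. -/
def hurwitzDerivs (Ω : Set ℂ) (w : ℂ) : Set ℝ :=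
  { r : ℝ | 0 < r ∧ ∃ h : ℂ → ℂ, DifferentiableOn ℂ h unitDisk ∧
    Set.MapsTo h unitDisk Ω ∧ h 0 = w ∧ (∀ t ∈ unitDisk, t ≠ 0 → h t ≠ w) ∧
    deriv h 0 = (r : ℂ) }

theorem hurwitzRadius_eq_sSup (Ω : Set ℂ) (w : ℂ) :
    hurwitzRadius Ω w = sSup (hurwitzDerivs Ω w) := rfl

theorem zero_mem_unitDisk : (0 : ℂ) ∈ unitDisk := by simp [mem_unitDisk]

theorem norm_deriv_mem_hurwitzDerivs {Ω : Set ℂ} {w : ℂ} {h : ℂ → ℂ}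
    (hd : DifferentiableOn ℂ h unitDisk) (hm : MapsTo h unitDisk Ω) (h0 : h 0 = w)
    (hw : ∀ t ∈ unitDisk, t ≠ 0 → h t ≠ w) (hne : deriv h 0 ≠ 0) :
    ‖deriv h 0‖ ∈ hurwitzDerivs Ω w := by
  have hn : (‖deriv h 0‖ : ℂ) ≠ 0 := by simpa using hne
  set u : ℂ := ‖deriv h 0‖ / deriv h 0 with hu
  have hu1 : ‖u‖ = 1 := by simp [hu, hne]
  have hu0 : u ≠ 0 := div_ne_zero hn hne
  have hmaps : MapsTo (fun t => u * t) unitDisk unitDisk := by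
    intro t ht
    simpa [mem_unitDisk, hu1] using ht
  refine ⟨norm_pos_iff.mpr hne, fun t => h (u * t), hd.comp (by fun_prop) hmaps,
    hm.comp hmaps, by simpa using h0, fun t ht ht0 => hw _ (hmaps ht) (mul_ne_zero hu0 ht0), ?_⟩
  have h1 : HasDerivAt h (deriv h 0) (u * 0) := by
    rw [mul_zero]
    exact (hd.differentiableAt (isOpen_unitDisk.mem_nhds zero_mem_unitDisk)).hasDerivAt
  have h2 : HasDerivAt (fun t : ℂ => u * t) u 0 := by
    simpa using (hasDerivAt_id (0 : ℂ)).const_mul u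
  have h3 : HasDerivAt (fun t => h (u * t)) (deriv h 0 * u) 0 := h1.comp (0 : ℂ) h2
  rw [h3.deriv, hu, mul_div_cancel₀ _ hne]

theorem hurwitzDerivs_nonempty {Ω : Set ℂ} (hΩ : IsOpen Ω) {w : ℂ} (hw : w ∈ Ω) :
    (hurwitzDerivs Ω w).Nonempty := by
  obtain ⟨δ, hδ, hball⟩ := Metric.isOpen_iff.mp hΩ w hw
  have hδ' : (δ : ℂ) ≠ 0 := by simpa using hδ.ne'
  refine ⟨δ, hδ, fun t => w + δ * t, by fun_prop, fun t ht => hball ?_, by simp, ?_, ?_⟩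
  · rw [mem_unitDisk] at ht
    rw [mem_ball, dist_eq_norm, add_sub_cancel_left, norm_mul, norm_real,
      Real.norm_of_nonneg hδ.le]
    nlinarith
  · intro t _ ht0
    simpa using ⟨hδ.ne', ht0⟩
  · simp

theorem mul_norm_deriv_mem_hurwitzDerivs {Y Ω : Set ℂ} (hY : IsOpen Y) {s w : ℂ} (hs : s ∈ Y)
    {h : ℂ → ℂ} (hd : DifferentiableOn ℂ h Y) (hm : MapsTo h Y Ω) (h0 : h s = w)
    (hw : ∀ t ∈ Y, t ≠ s → h t ≠ w) (hne : deriv h s ≠ 0) {r : ℝ} (hr : r ∈ hurwitzDerivs Y s) :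
    r * ‖deriv h s‖ ∈ hurwitzDerivs Ω w := by
  obtain ⟨hr0, k, hkd, hkm, hk0, hks, hkr⟩ := hr
  have hder : deriv (h ∘ k) 0 = deriv h s * r := by
    rw [← hkr, deriv_comp, hk0]
    · rw [hk0]
      exact hd.differentiableAt (hY.mem_nhds hs)
    · exact hkd.differentiableAt (isOpen_unitDisk.mem_nhds zero_mem_unitDisk)
  have hnorm : r * ‖deriv h s‖ = ‖deriv (h ∘ k) 0‖ := by
    rw [hder, norm_mul, norm_real, Real.norm_of_nonneg hr0.le, mul_comm]
  rw [hnorm]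
  refine norm_deriv_mem_hurwitzDerivs (hd.comp hkd hkm) (hm.comp hkm) (by simp [hk0, h0])
    (fun t ht ht0 => hw _ (hkm ht) (hks t ht ht0)) ?_
  rw [hder]
  exact mul_ne_zero hne (by exact_mod_cast hr0.ne')

/-- The contraction property of the Hurwitz density. -/
theorem hurwitzDensity_le_genHurwitzDensity {Y Ω : Set ℂ} (hY : IsOpen Y) (w : ℂ) :
    ENNReal.ofReal (hurwitzDensity Ω w) ≤ genHurwitzDensity Y Ω w := by
  refine le_sInf ?_
  rintro _ ⟨s, hs, h, hd, hm, h0, hw, hne, rfl⟩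
  refine ENNReal.ofReal_le_ofReal ?_
  have hmem : ∀ r ∈ hurwitzDerivs Y s, r * ‖deriv h s‖ ∈ hurwitzDerivs Ω w := fun r hr =>
    mul_norm_deriv_mem_hurwitzDerivs hY hs hd hm h0 hw hne hr
  have hpos : 0 < ‖deriv h s‖ := norm_pos_iff.mpr hne
  rw [hurwitzDensity, hurwitzDensity, hurwitzRadius_eq_sSup, hurwitzRadius_eq_sSup]
  by_cases hb : BddAbove (hurwitzDerivs Ω w)
  · obtain ⟨r, hr⟩ := hurwitzDerivs_nonempty hY hs
    have hle : ∀ r ∈ hurwitzDerivs Y s, r ≤ sSup (hurwitzDerivs Ω w) / ‖deriv h s‖ :=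
      fun r hr => (le_div_iff₀ hpos).mpr (le_csSup hb (hmem r hr))
    have hYpos : 0 < sSup (hurwitzDerivs Y s) := hr.1.trans_le (le_csSup ⟨_, hle⟩ hr)
    rw [div_div]
    refine div_le_div_of_nonneg_left zero_le_two (mul_pos hYpos hpos) ?_
    exact (le_div_iff₀ hpos).mp (csSup_le ⟨r, hr⟩ hle)
  · rw [Real.sSup_of_not_bddAbove hb, div_zero]
    exact div_nonneg (div_nonneg zero_le_two (Real.sSup_nonneg fun r hr => hr.1.le)) hpos.le

theorem IsDiskEmbedding.div_norm_deriv_le_hurwitzRadius {Y : Set ℂ} (hY : IsOpen Y) {f : ℂ → ℂ}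
    (hf : IsDiskEmbedding Y f) {s : ℂ} (hs : s ∈ Y) (hfs : f s = 0) {ρ : ℝ} (hρ : 0 < ρ)
    (hball : ball 0 ρ ⊆ f '' Y) : ρ / ‖deriv f s‖ ≤ hurwitzRadius Y s := by
  have hne := hf.deriv_ne_zero s hs
  have hinj : ∀ t ∈ Y, t ≠ s → f t ≠ 0 := fun t ht hts h =>
    hts (hf.injOn ht hs (h.trans hfs.symm))
  have hbdd : BddAbove (hurwitzDerivs Y s) := by
    refine ⟨1 / ‖deriv f s‖, fun r hr => ?_⟩
    obtain ⟨-, k, hkd, hkm, hk0, -, hkr⟩ :=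
      mul_norm_deriv_mem_hurwitzDerivs hY hs hf.differentiableOn hf.mapsTo hfs hinj hne hr
    rw [le_div_iff₀ (norm_pos_iff.mpr hne)]
    refine (Complex.ofReal_re _ ▸ Complex.re_le_norm _).trans (hkr ▸ ?_)
    refine norm_deriv_le_one_of_mapsTo_ball hkd ?_ one_pos
    rw [hk0]
    exact fun z hz => ball_subset_closedBall (hkm hz)
  obtain ⟨g, hg, hgd⟩ := hf.exists_inverse hY
  have hmem : ∀ t ∈ unitDisk, (ρ : ℂ) * t ∈ f '' Y := by
    intro t ht
    refine hball ?_
    rw [mem_unitDisk] at ht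
    rw [mem_ball_zero_iff, norm_mul, norm_real, Real.norm_of_nonneg hρ.le]
    nlinarith
  have hder : ∀ t ∈ unitDisk, ∀ y ∈ Y, f y = ρ * t →
      HasDerivAt (fun t => g (ρ * t)) ((deriv f y)⁻¹ * ρ) t := by
    intro t _ y hy hyt
    have h1 := hgd y hy
    rw [hyt] at h1
    exact h1.comp t (by simpa using (hasDerivAt_id t).const_mul (ρ : ℂ))
  have hder0 : deriv (fun t => g (ρ * t)) 0 = (deriv f s)⁻¹ * ρ :=
    (hder 0 zero_mem_unitDisk s hs (by simp [hfs])).deriv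
  have hg0 : g (ρ * 0) = s := by rw [mul_zero, ← hfs, hg hs]
  have hρ' : (ρ : ℂ) ≠ 0 := by exact_mod_cast hρ.ne'
  have hkey : ‖deriv (fun t => g (ρ * t)) 0‖ ∈ hurwitzDerivs Y s := by
    refine norm_deriv_mem_hurwitzDerivs (fun t ht => ?_) (fun t ht => ?_) hg0
      (fun t ht ht0 => ?_) ?_
    · obtain ⟨y, hy, hyt⟩ := hmem t ht
      exact (hder t ht y hy hyt).differentiableAt.differentiableWithinAt
    · obtain ⟨y, hy, hyt⟩ := hmem t ht
      simpa only [← hyt, hg hy] using hy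
    · obtain ⟨y, hy, hyt⟩ := hmem t ht
      rw [← hyt, hg hy]
      rintro rfl
      exact mul_ne_zero hρ' ht0 (hyt.symm.trans hfs)
    · rw [hder0]
      exact mul_ne_zero (inv_ne_zero hne) hρ'
  refine le_trans (le_of_eq ?_) (le_csSup hbdd hkey)
  rw [hder0, norm_mul, norm_inv, norm_real, Real.norm_of_nonneg hρ.le]
  ring

theorem genHurwitzDensity_le_of_mem {Y Ω : Set ℂ} (hY : IsOpen Y) (hYs : IsSimplyConnected Y)
    (hYp : Y ≠ univ) {w : ℂ} {r : ℝ} (hr : r ∈ hurwitzDerivs Ω w) {t : ℝ} (ht : 0 < t)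
    (htr : t < r) : genHurwitzDensity Y Ω w ≤ ENNReal.ofReal (2 / t) := by
  obtain ⟨hr0, g, hgd, hgm, hg0, hgw, hgr⟩ := hr
  obtain ⟨s, hs⟩ := hYs.nonempty
  obtain ⟨f, hf, hfs, hball⟩ := exists_isDiskEmbedding_ball_subset hY hYs hYp hs
    (div_pos ht hr0) ((div_lt_one hr0).mpr htr)
  have hrad := hf.div_norm_deriv_le_hurwitzRadius hY hs hfs (div_pos ht hr0) hball
  have hpos : 0 < ‖deriv f s‖ := norm_pos_iff.mpr (hf.deriv_ne_zero s hs)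
  have hder : deriv (g ∘ f) s = r * deriv f s := by
    rw [← hgr, deriv_comp, hfs]
    · rw [hfs]
      exact hgd.differentiableAt (isOpen_unitDisk.mem_nhds zero_mem_unitDisk)
    · exact hf.differentiableAt hs
  have hle : genHurwitzDensity Y Ω w ≤
      ENNReal.ofReal (hurwitzDensity Y s / ‖deriv (g ∘ f) s‖) := by
    refine sInf_le ⟨s, hs, g ∘ f, hgd.comp hf.differentiableOn hf.mapsTo, hgm.comp hf.mapsTo,
      by simp [hfs, hg0], fun y hy hys => hgw _ (hf.mapsTo hy) fun h => hys
        (hf.injOn hy hs (h.trans hfs.symm)), ?_, rfl⟩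
    rw [hder]
    exact mul_ne_zero (by exact_mod_cast hr0.ne') (hf.deriv_ne_zero s hs)
  refine hle.trans (ENNReal.ofReal_le_ofReal ?_)
  rw [hder, norm_mul, norm_real, Real.norm_of_nonneg hr0.le, hurwitzDensity, div_div]
  refine div_le_div_of_nonneg_left zero_le_two ht ?_
  calc t = t / r / ‖deriv f s‖ * (r * ‖deriv f s‖) := by field_simp
    _ ≤ _ := by gcongr

theorem genHurwitzDensity_eq {Y Ω : Set ℂ} (hY : IsOpen Y) (hYs : IsSimplyConnected Y)
    (hYp : Y ≠ univ) (hΩ : IsOpen Ω) {w : ℂ} (hw : w ∈ Ω) :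
    genHurwitzDensity Y Ω w = ENNReal.ofReal (hurwitzDensity Ω w) := by
  refine le_antisymm ?_ (hurwitzDensity_le_genHurwitzDensity hY w)
  obtain ⟨r₀, hr₀⟩ := hurwitzDerivs_nonempty hΩ hw
  rw [hurwitzDensity, hurwitzRadius_eq_sSup]
  by_cases hb : BddAbove (hurwitzDerivs Ω w)
  · have hR : 0 < sSup (hurwitzDerivs Ω w) := hr₀.1.trans_le (le_csSup hb hr₀)
    have hlim : Filter.Tendsto (fun t : ℝ => ENNReal.ofReal (2 / t))
        (nhdsWithin (sSup (hurwitzDerivs Ω w)) (Iio (sSup (hurwitzDerivs Ω w))))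
        (nhds (ENNReal.ofReal (2 / sSup (hurwitzDerivs Ω w)))) :=
      ENNReal.tendsto_ofReal
        ((continuousAt_const.div continuousAt_id hR.ne').tendsto.mono_left nhdsWithin_le_nhds)
    refine ge_of_tendsto hlim ?_
    filter_upwards [Ioo_mem_nhdsLT hR] with t ht
    obtain ⟨r, hr, htr⟩ := exists_lt_of_lt_csSup ⟨r₀, hr₀⟩ ht.2
    exact genHurwitzDensity_le_of_mem hY hYs hYp hr ht.1 htr
  · rw [Real.sSup_of_not_bddAbove hb, div_zero]
    have hlim : Filter.Tendsto (fun t : ℝ => ENNReal.ofReal (2 / t)) Filter.atTop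
        (nhds (ENNReal.ofReal 0)) :=
      ENNReal.tendsto_ofReal (Filter.tendsto_id.const_div_atTop 2)
    refine ge_of_tendsto hlim ?_
    filter_upwards [Filter.eventually_gt_atTop 0] with t ht
    obtain ⟨r, hr, htr⟩ := not_bddAbove_iff.mp hb t
    exact genHurwitzDensity_le_of_mem hY hYs hYp hr ht htr

theorem isSimplyConnected_unitDisk : IsSimplyConnected unitDisk := by
  have : ContractibleSpace unitDisk :=
    (convex_ball (0 : ℂ) 1).contractibleSpace ⟨0, zero_mem_unitDisk⟩
  exact SimplyConnectedSpace.ofContractible _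

theorem unitDisk_ne_univ : unitDisk ≠ univ := fun h => by
  have h1 : (1 : ℂ) ∈ unitDisk := h ▸ mem_univ 1
  simp [mem_unitDisk] at h1

/-- for a simply connected basepoint domain `Y ⊊ ℂ`,
`η_Ω^𝔻 = η_Ω^Y = η_Ω`. -/
theorem genHurwitz_simply_connected_base
    (Y Ω : Set ℂ) (hY : IsPlaneDomain Y) (hYp : Y ≠ Set.univ)
    (hsc : SimplyConnectedSpace ↥Y)
    (hΩ : IsPlaneDomain Ω) (hΩp : Ω ≠ Set.univ) :
    ∀ w ∈ Ω,
      genHurwitzDensity unitDisk Ω w = genHurwitzDensity Y Ω w ∧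
      genHurwitzDensity Y Ω w = ENNReal.ofReal (hurwitzDensity Ω w) := by
  intro w hw
  have hYw := genHurwitzDensity_eq hY.1 hsc hYp hΩ.1 hw
  exact ⟨(genHurwitzDensity_eq isOpen_unitDisk isSimplyConnected_unitDisk unitDisk_ne_univ
    hΩ.1 hw).trans hYw.symm, hYw⟩
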